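/- arXiv:1604.02755 — 3 statements merged into one kernel-verified Lean document; each statement's English description precedes it below -/
import Mathlib

section
/- Let n, k be positive integers and suppose there exists an (n,k) circuit code of even length N > 2(k+1)². Then there exists an (n+1, k) circuit code of length N' = 2(k+1)⌈N/(2(k+1))⌉; in particular, N' is divisible by k+1. -/
/-- The cyclic distance between two positions on a cycle of length `N`:
the minimum of the two arc lengths. -/
def cycDist {N : ℕ} (i j : ZMod N) : ℕ := min (j - i).val (i - j).val

/-- `C` is an `(n,k)` circuit code of length `N`: a cyclic sequence of `N` distinct
vertices of the hypercube `I(n)` forming an induced cycle such that vertices at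
Hamming distance `< k` are at equal cyclic distance. -/
structure IsCircuitCode (n k N : ℕ) (C : ZMod N → (Fin n → Bool)) : Prop where
  inj : Function.Injective C
  adj : ∀ i : ZMod N, hammingDist (C i) (C (i + 1)) = 1
  induced : ∀ i j : ZMod N, i ≠ j → j ≠ i + 1 → i ≠ j + 1 →
    hammingDist (C i) (C j) ≠ 1
  spread : ∀ i j : ZMod N, hammingDist (C i) (C j) < k →
    cycDist i j = hammingDist (C i) (C j)

/-- There exists an `(n,k)` circuit code of length `N`. -/
def ExistsCircuitCode (n k N : ℕ) : Prop :=
  ∃ C : ZMod N → (Fin n → Bool), IsCircuitCode n k N C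

/-- `K n k` is the maximum length of an `(n,k)` circuit code. -/
noncomputable def K (n k : ℕ) : ℕ := sSup {N | ExistsCircuitCode n k N}

theorem cycDist_comm {N : ℕ} (i j : ZMod N) : cycDist i j = cycDist j i := by
  simp [cycDist, min_comm]

theorem cycDist_of_val_le {N : ℕ} [NeZero N] {i j : ZMod N} (h : i.val ≤ j.val) :
    cycDist i j = min (j.val - i.val) (N - (j.val - i.val)) := by
  have hv : (j - i).val = j.val - i.val := ZMod.val_sub h
  have hw : i - j = -(j - i) := by ring
  unfold cycDist
  rw [hw, ZMod.neg_val, hv]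
  split_ifs with h0
  · rw [h0, ZMod.val_zero] at hv
    omega
  · rfl

theorem val_add_one_eq {N : ℕ} [NeZero N] (hN : 1 < N) (i : ZMod N) :
    (i + 1).val = i.val + 1 ∧ i.val + 1 < N ∨ (i + 1).val = 0 ∧ i.val + 1 = N := by
  have h1 : (1 : ZMod N).val = 1 := ZMod.val_one'' (by omega)
  have hi := ZMod.val_lt i
  rcases Nat.lt_or_ge (i.val + 1) N with h | h
  · left
    exact ⟨by rw [ZMod.val_add_of_lt (by omega), h1], h⟩
  · right
    have he : i.val + 1 = N := by omega
    refine ⟨?_, he⟩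
    rw [ZMod.val_add, h1, he, Nat.mod_self]

theorem cycDist_add_one {N : ℕ} [NeZero N] (hN : 1 < N) (i : ZMod N) :
    cycDist i (i + 1) = 1 := by
  rcases val_add_one_eq hN i with ⟨h, hlt⟩ | ⟨h, he⟩
  · rw [cycDist_of_val_le (by omega)]
    omega
  · rw [cycDist_comm, cycDist_of_val_le (by omega)]
    omega

theorem eq_of_cycDist_eq_zero {N : ℕ} [NeZero N] {i j : ZMod N} (h : cycDist i j = 0) :
    i = j := by
  have hi := ZMod.val_lt i
  have hj := ZMod.val_lt j
  apply ZMod.val_injective N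
  rcases le_total i.val j.val with hle | hle
  · rw [cycDist_of_val_le hle] at h
    omega
  · rw [cycDist_comm, cycDist_of_val_le hle] at h
    omega

theorem eq_add_one_of_cycDist_eq_one {N : ℕ} [NeZero N] (hN : 1 < N) {i j : ZMod N}
    (h : cycDist i j = 1) : j = i + 1 ∨ i = j + 1 := by
  have h1 : (1 : ZMod N).val = 1 := ZMod.val_one'' (by omega)
  have key : ∀ a b : ZMod N, (b - a).val = 1 → b = a + 1 := by
    intro a b hab
    have : b - a = 1 := ZMod.val_injective N (hab.trans h1.symm)
    rw [← this]
    ring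
  unfold cycDist at h
  rcases min_choice (j - i).val (i - j).val with hm | hm
  · exact Or.inl (key i j (by omega))
  · exact Or.inr (key j i (by omega))

/-- In a circuit code the spread condition also holds at Hamming distances `0` and `1`. -/
theorem IsCircuitCode.cycDist_eq {n k N : ℕ} [NeZero N] (hN : 1 < N) {C : ZMod N → Fin n → Bool}
    (hC : IsCircuitCode n k N C) {i j : ZMod N}
    (h : hammingDist (C i) (C j) < k ∨ hammingDist (C i) (C j) < 2) :
    cycDist i j = hammingDist (C i) (C j) := by
  rcases h with h | h
  · exact hC.spread i j h
  · by_cases hij : i = j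
    · subst hij
      simp [cycDist]
    have h0 : hammingDist (C i) (C j) ≠ 0 := by
      rw [Ne, hammingDist_eq_zero]
      exact fun he => hij (hC.inj he)
    have h1 : hammingDist (C i) (C j) = 1 := by omega
    rw [h1]
    by_cases hj : j = i + 1
    · rw [hj, cycDist_add_one hN]
    by_cases hi : i = j + 1
    · rw [hi, cycDist_comm, cycDist_add_one hN]
    exact absurd h1 (hC.induced i j hij hj hi)

theorem isCircuitCode_of_cycDist_eq {n k N : ℕ} [NeZero N] (hN : 1 < N)
    {C : ZMod N → Fin n → Bool} (hadj : ∀ i, hammingDist (C i) (C (i + 1)) = 1)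
    (h : ∀ i j, hammingDist (C i) (C j) < k ∨ hammingDist (C i) (C j) < 2 →
      cycDist i j = hammingDist (C i) (C j)) :
    IsCircuitCode n k N C where
  inj i j hij := by
    have h0 : hammingDist (C i) (C j) = 0 := by rw [hij, hammingDist_self]
    exact eq_of_cycDist_eq_zero ((h i j (Or.inr (by omega))).trans h0)
  adj := hadj
  induced i j _ hj hi h1 := by
    rcases eq_add_one_of_cycDist_eq_one hN ((h i j (Or.inr (by omega))).trans h1) with he | he
    · exact hj he
    · exact hi he
  spread i j hij := h i j (Or.inl hij)

theorem hammingDist_cons {n : ℕ} (a b : Bool) (x y : Fin n → Bool) :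
    hammingDist (Fin.cons a x : Fin (n + 1) → Bool) (Fin.cons b y) =
      (if a = b then 0 else 1) + hammingDist x y := by
  simp only [hammingDist, Finset.card_filter, Fin.sum_univ_succ, Fin.cons_zero, Fin.cons_succ]
  split_ifs <;> simp_all

/-- The number of multiples `q * (k + 2)` with `q < t` that are less than `p`. -/
def flipCount (k t p : ℕ) : ℕ := min t ((p + k + 1) / (k + 2))

theorem flipCount_le (k t p : ℕ) : flipCount k t p ≤ t := min_le_left _ _

theorem flipCount_zero (k t : ℕ) : flipCount k t 0 = 0 := by
  simp [flipCount]

theorem flipCount_mono (k t : ℕ) : Monotone (flipCount k t) := by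
  intro p q h
  exact min_le_min_left _ (Nat.div_le_div_right (by omega))

theorem flipCount_succ_le (k t p : ℕ) : flipCount k t (p + 1) ≤ flipCount k t p + 1 := by
  have : (p + 1 + k + 1) / (k + 2) ≤ (p + k + 1) / (k + 2) + 1 := by
    rw [← Nat.add_div_right _ (by omega : 0 < k + 2)]
    exact Nat.div_le_div_right (by omega)
  unfold flipCount
  omega

theorem mul_flipCount_le (k t p : ℕ) : (k + 2) * flipCount k t p ≤ p + k + 1 :=
  (Nat.mul_le_mul_left _ (min_le_right _ _)).trans (Nat.mul_div_le _ _)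

theorem le_mul_flipCount {k t p : ℕ} (h : flipCount k t p < t) :
    p ≤ (k + 2) * flipCount k t p := by
  have he : flipCount k t p = (p + k + 1) / (k + 2) := by
    unfold flipCount at *
    omega
  have := Nat.lt_mul_div_succ (p + k + 1) (by omega : 0 < k + 2)
  rw [he]
  rw [Nat.mul_add] at this
  omega

theorem flipCount_of_le {k t p : ℕ} (h : (k + 2) * t ≤ p) : flipCount k t p = t := by
  refine min_eq_left ?_
  rw [Nat.le_div_iff_mul_le (by omega)]
  linarith [mul_comm t (k + 2)]

theorem flipCount_le_self (k t p : ℕ) : flipCount k t p ≤ p := by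
  have := mul_flipCount_le k t p
  by_contra! h
  nlinarith

theorem ite_decide_odd {x y d : ℕ} (hd : d ≤ 1) (h : x = y + d) :
    (if decide (Odd x) = decide (Odd y) then 0 else 1) = d := by
  have hd' : d = 0 ∨ d = 1 := by omega
  rcases hd' with rfl | rfl
  · simp [h]
  · subst h
    by_cases hy : Odd y <;> simp [hy, Nat.odd_add_one]

/-- Insert `t` transitions in a new coordinate, one before each of the first `t` blocks of `k + 1`
transitions of `C`. -/
def insertFlips {n N : ℕ} (k t : ℕ) (C : ZMod N → Fin n → Bool) (p : ℕ) : Fin (n + 1) → Bool :=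
  Fin.cons (decide (Odd (flipCount k t p))) (C ((p - flipCount k t p : ℕ) : ZMod N))

theorem IsCircuitCode.insertFlips_adj {n k N t : ℕ} {C : ZMod N → Fin n → Bool}
    (hC : IsCircuitCode n k N C) (p : ℕ) :
    hammingDist (insertFlips k t C p) (insertFlips k t C (p + 1)) = 1 := by
  have h1 := flipCount_succ_le k t p
  have h2 := flipCount_mono k t (Nat.le_add_right p 1)
  have h3 := flipCount_le_self k t p
  unfold insertFlips
  rw [hammingDist_comm, hammingDist_cons]
  have hf : flipCount k t (p + 1) = flipCount k t p ∨
    flipCount k t (p + 1) = flipCount k t p + 1 := by omega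
  rcases hf with hf | hf
  · have hc : p + 1 - flipCount k t (p + 1) = p - flipCount k t p + 1 := by omega
    rw [ite_decide_odd (d := 0) zero_le_one (by omega), hc, hammingDist_comm, Nat.cast_succ, hC.adj]
  · have hc : p + 1 - flipCount k t (p + 1) = p - flipCount k t p := by omega
    rw [ite_decide_odd (d := 1) le_rfl (by omega), hc, hammingDist_self]

theorem IsCircuitCode.insertFlips_dist {n k N t : ℕ} [NeZero N] {C : ZMod N → Fin n → Bool}
    (hC : IsCircuitCode n k N C) (hk : 0 < k) (ht : Even t) (hN : (k + 1) * (t + 2) ≤ N)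
    {p q : ℕ} (hpq : p ≤ q) (hq : q < N + t)
    (h : hammingDist (insertFlips k t C p) (insertFlips k t C q) < k ∨
      hammingDist (insertFlips k t C p) (insertFlips k t C q) < 2) :
    min (q - p) (N + t - (q - p)) = hammingDist (insertFlips k t C p) (insertFlips k t C q) := by
  have hle := flipCount_mono k t hpq
  have hxp := flipCount_le_self k t p
  have hyq := flipCount_le_self k t q
  have hyt := flipCount_le k t q
  have hx1 := mul_flipCount_le k t p
  have hx2 := le_mul_flipCount (k := k) (t := t) (p := p)
  have hy1 := mul_flipCount_le k t q
  have hy2 := le_mul_flipCount (k := k) (t := t) (p := q)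
  have hN1 : 1 < N := by nlinarith
  unfold insertFlips at h ⊢
  rw [hammingDist_comm, hammingDist_cons, hammingDist_comm] at h ⊢
  generalize flipCount k t p = x at *
  generalize flipCount k t q = y at *
  obtain ⟨c, rfl⟩ := Nat.exists_eq_add_of_le' hxp
  obtain ⟨d, rfl⟩ := Nat.exists_eq_add_of_le' hyq
  rw [Nat.add_sub_cancel, Nat.add_sub_cancel] at h ⊢
  obtain ⟨e, hye⟩ := Nat.exists_eq_add_of_le hle
  obtain ⟨g, hg⟩ := Nat.exists_eq_add_of_le hyt
  have hcx : (k + 1) * x ≤ c + (k + 1) := by linarith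
  have hcx' : x < t → c ≤ (k + 1) * x := fun hx => by linarith [hx2 hx]
  have hdy : (k + 1) * y ≤ d + (k + 1) := by linarith
  have hdy' : y < t → d ≤ (k + 1) * y := fun hy => by linarith [hy2 hy]
  have hcd : c ≤ d := by
    rcases Nat.eq_zero_or_pos e with he | he
    · omega
    · have := hcx' (by omega)
      have := Nat.mul_le_mul_left (k + 1) (show x + 1 ≤ y by omega)
      linarith
  have hdN : d < N := by
    rcases hyt.lt_or_eq with hy | hy
    · have := Nat.mul_le_mul_left (k + 1) hyt
      linarith [hdy' hy]
    · omega
  have hC' := hC.cycDist_eq hN1 (i := (c : ZMod N)) (j := (d : ZMod N)) (by omega)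
  have hcv : (c : ZMod N).val = c := ZMod.val_cast_of_lt (by omega)
  have hdv : (d : ZMod N).val = d := ZMod.val_cast_of_lt hdN
  rw [cycDist_of_val_le (by rwa [hcv, hdv]), hcv, hdv] at hC'
  rw [← hC'] at h ⊢
  have hak : min (d - c) (N - (d - c)) ≤ k := by omega
  have h2 : 2 * (k + 1) ≤ N + t := by linarith [Nat.zero_le ((k + 1) * t)]
  rcases min_choice (d - c) (N - (d - c)) with ha | ha
  · have he : e ≤ 1 := by
      by_contra! he
      have hcx'' := hcx' (by omega)
      have : d ≤ c + k := by omega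
      have := Nat.mul_le_mul_left (k + 1) (show x + 2 ≤ y by omega)
      linarith
    rw [ite_decide_odd he hye, ha]
    rw [ha] at hak
    omega
  · have he : x + g ≤ 1 := by
      by_contra! he
      have : N + c ≤ d + k := by omega
      rcases hyt.lt_or_eq with hy | hy
      · have := Nat.mul_le_mul_left (k + 1) hyt
        linarith [hdy' hy]
      · have := Nat.mul_le_mul_left (k + 1) (show 2 ≤ x by omega)
        linarith
    have hpar : (if decide (Odd y) = decide (Odd x) then 0 else 1) = x + g := by
      obtain ⟨r, hr⟩ := ht
      simp only [decide_eq_decide, Nat.odd_iff]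
      split_ifs <;> omega
    rw [hpar, ha]
    rw [ha] at hak
    omega

theorem stmt_15 (n k N : ℕ) (hn : 0 < n) (hk : 0 < k) (hNeven : Even N)
    (hN : 2 * (k + 1) ^ 2 < N) (h : ExistsCircuitCode n k N) :
    ExistsCircuitCode (n + 1) k (2 * (k + 1) * ⌈(N : ℝ) / (2 * (k + 1))⌉₊) ∧
      (k + 1) ∣ 2 * (k + 1) * ⌈(N : ℝ) / (2 * (k + 1))⌉₊ := by
  obtain ⟨C, hC⟩ := h
  set m := ⌈(N : ℝ) / (2 * (k + 1))⌉₊ with hm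
  refine ⟨?_, ⟨2 * m, by ring⟩⟩
  have hpos : (0 : ℝ) < 2 * (k + 1) := by positivity
  have hle : N ≤ 2 * (k + 1) * m := by
    have := Nat.le_ceil ((N : ℝ) / (2 * (k + 1)))
    rw [← hm, div_le_iff₀ hpos] at this
    have h' : (N : ℝ) ≤ ((2 * (k + 1) * m : ℕ) : ℝ) := by push_cast; linarith
    exact_mod_cast h'
  have hlt : 2 * (k + 1) * m < N + 2 * (k + 1) := by
    have := Nat.ceil_lt_add_one (a := (N : ℝ) / (2 * (k + 1))) (by positivity)
    rw [← hm, ← sub_lt_iff_lt_add, lt_div_iff₀ hpos] at this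
    have h' : ((2 * (k + 1) * m : ℕ) : ℝ) < ((N + 2 * (k + 1) : ℕ) : ℝ) := by
      push_cast; linarith
    exact_mod_cast h'
  obtain ⟨t, ht⟩ := Nat.exists_eq_add_of_le hle
  rw [ht] at hlt ⊢
  have hteven : Even t := by
    have : Even (N + t) := by rw [← ht, mul_assoc]; exact even_two_mul _
    exact (Nat.even_add.mp this).mp hNeven
  have htk : t + 2 ≤ 2 * (k + 1) := by
    obtain ⟨r, rfl⟩ := hteven
    omega
  have hNt : (k + 1) * (t + 2) ≤ N := by nlinarith
  have hN1 : 1 < N := by nlinarith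
  have : NeZero N := ⟨by omega⟩
  have : NeZero (N + t) := ⟨by omega⟩
  refine ⟨fun i => insertFlips k t C i.val,
    isCircuitCode_of_cycDist_eq (by omega) (fun i => ?_) (fun i j hij => ?_)⟩
  · have hadj := hC.insertFlips_adj (t := t) i.val
    rcases val_add_one_eq (by omega) i with ⟨h, -⟩ | ⟨h, he⟩
    · simpa only [h] using hadj
    · rw [he] at hadj
      have h0 : insertFlips k t C (N + t) = insertFlips k t C 0 := by
        unfold insertFlips
        rw [flipCount_of_le (by nlinarith), flipCount_zero, Nat.add_sub_cancel]
        simp [Nat.not_odd_iff_even.mpr hteven]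
      simpa only [h, h0] using hadj
  · rcases le_total i.val j.val with hle | hle
    · rw [cycDist_of_val_le hle]
      exact hC.insertFlips_dist hk hteven hNt hle (ZMod.val_lt j) hij
    · rw [hammingDist_comm] at hij ⊢
      rw [cycDist_comm, cycDist_of_val_le hle]
      exact hC.insertFlips_dist hk hteven hNt hle (ZMod.val_lt i) hij
end

section
/- (Singleton) For all positive integers n and k with 2 ≤ n < ⌊3k/2⌋ + 2, K(n, k) = 2n; that is, the maximum length of an (n,k) circuit code equals 2n. -/
/-- The number of indices in `[i, i + L)` at which the sequence `w` takes the value `s`. -/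
def occ {n : ℕ} (w : ℕ → Fin n) (i L : ℕ) (s : Fin n) : ℕ :=
  ∑ j ∈ Finset.range L, if w (i + j) = s then 1 else 0

section Occ

variable {n : ℕ} (w : ℕ → Fin n)

theorem occ_add (i L M : ℕ) (s : Fin n) :
    occ w i (L + M) s = occ w i L s + occ w (i + L) M s := by
  simp only [occ, Finset.sum_range_add, add_assoc]

theorem occ_one (i : ℕ) (s : Fin n) : occ w i 1 s = if w i = s then 1 else 0 := by
  simp only [occ, Finset.sum_range_one, add_zero]

theorem occ_mono {i L M : ℕ} (h : L ≤ M) (s : Fin n) : occ w i L s ≤ occ w i M s := by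
  obtain ⟨d, rfl⟩ := Nat.exists_eq_add_of_le h
  rw [occ_add]
  exact Nat.le_add_right _ _

theorem sum_occ (i L : ℕ) : ∑ s, occ w i L s = L := by
  unfold occ
  rw [Finset.sum_comm]
  simp

/-- If all windows of length `m` have distinct entries, then a window of length `2m + 1` whose
first and middle entries differ contains every value at most twice. -/
theorem occ_le_two {m i : ℕ} (hm : ∀ i s, occ w i m s ≤ 1) (hi : w i ≠ w (i + m)) (s : Fin n) :
    occ w i (2 * m + 1) s ≤ 2 := by
  have e1 : occ w i (2 * m + 1) s = occ w i m s + (occ w (i + m) 1 s + occ w (i + m + 1) m s) := by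
    rw [← occ_add, ← occ_add]; congr 1; ring
  have e2 : occ w i (2 * m + 1) s
      = occ w i 1 s + (occ w (i + 1) m s + occ w (i + 1 + m) m s) := by
    rw [← occ_add, ← occ_add]; congr 1; ring
  have h1 := hm i s
  have h2 := hm (i + m + 1) s
  have h3 := hm (i + 1) s
  have h4 := hm (i + 1 + m) s
  rw [occ_one] at e1 e2
  by_cases ha : w i = s
  · have hb : w (i + m) ≠ s := fun hb => hi (ha.trans hb.symm)
    rw [if_neg hb] at e1
    omega
  · rw [if_neg ha] at e2
    omega

end Occ

section Walk

variable {n : ℕ} {f : ℕ → Fin n → Bool} {w : ℕ → Fin n}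

theorem ne_iff_odd_occ (hw : ∀ i t, f i t ≠ f (i + 1) t ↔ w i = t) (i L : ℕ) (s : Fin n) :
    f i s ≠ f (i + L) s ↔ Odd (occ w i L s) := by
  induction L with
  | zero => simp [occ]
  | succ L ih =>
    rw [occ_add, occ_one]
    have h := hw (i + L) s
    rw [← add_assoc]
    by_cases hs : w (i + L) = s
    · have h' := h.2 hs
      rw [if_pos hs, Nat.odd_add_one, ← ih]
      revert h'
      cases f i s <;> cases f (i + L) s <;> cases f (i + L + 1) s <;> simp
    · have h' : f (i + L) s = f (i + L + 1) s := by
        by_contra hc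
        exact hs (h.1 hc)
      rw [if_neg hs, add_zero, ← ih, h']

theorem hammingDist_eq_sum_occ_mod_two (hw : ∀ i t, f i t ≠ f (i + 1) t ↔ w i = t) (i L : ℕ) :
    hammingDist (f i) (f (i + L)) = ∑ s, occ w i L s % 2 := by
  unfold hammingDist
  rw [Finset.card_filter]
  refine Finset.sum_congr rfl fun s _ => ?_
  have h := ne_iff_odd_occ hw i L s
  split_ifs with hs
  · exact (Nat.odd_iff.1 (h.1 hs)).symm
  · exact (Nat.even_iff.1 (Nat.not_odd_iff_even.1 fun ho => hs (h.2 ho))).symm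

theorem hammingDist_mod_two (hw : ∀ i t, f i t ≠ f (i + 1) t ↔ w i = t) (i L : ℕ) :
    hammingDist (f i) (f (i + L)) % 2 = L % 2 := by
  rw [hammingDist_eq_sum_occ_mod_two hw, ← Finset.sum_nat_mod, sum_occ]

theorem occ_le_one_of_le_hammingDist (hw : ∀ i t, f i t ≠ f (i + 1) t ↔ w i = t) {i L : ℕ}
    (h : L ≤ hammingDist (f i) (f (i + L))) (s : Fin n) : occ w i L s ≤ 1 := by
  rw [hammingDist_eq_sum_occ_mod_two hw] at h
  have hle : ∀ t ∈ Finset.univ, occ w i L t % 2 ≤ occ w i L t := fun t _ => Nat.mod_le _ _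
  have heq := (Finset.sum_eq_sum_iff_of_le hle).1
    (le_antisymm (Finset.sum_le_sum hle) (by rwa [sum_occ])) s (Finset.mem_univ s)
  omega

theorem hammingDist_add_le_of_occ_le_two (hw : ∀ i t, f i t ≠ f (i + 1) t ↔ w i = t) {i L : ℕ}
    (h : ∀ s, occ w i L s ≤ 2) : hammingDist (f i) (f (i + L)) + L ≤ 2 * n := by
  rw [hammingDist_eq_sum_occ_mod_two hw]
  calc ∑ s, occ w i L s % 2 + L = ∑ s, (occ w i L s % 2 + occ w i L s) := by
        rw [Finset.sum_add_distrib, sum_occ]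
    _ ≤ ∑ _s : Fin n, 2 := Finset.sum_le_sum fun s _ => by have := h s; omega
    _ = 2 * n := by simp [mul_comm]

end Walk

theorem cycDist_natCast_add {N : ℕ} (i : ℕ) {L : ℕ} (h0 : 0 < L) (hL : L < N) :
    cycDist (i : ZMod N) ((i + L : ℕ) : ZMod N) = min L (N - L) := by
  have : NeZero N := ⟨by omega⟩
  have hv : (L : ZMod N).val = L := ZMod.val_cast_of_lt hL
  have hne : (L : ZMod N) ≠ 0 := by
    intro h
    rw [h, ZMod.val_zero] at hv
    omega
  unfold cycDist
  rw [Nat.cast_add, add_sub_cancel_left, sub_add_cancel_left, ZMod.neg_val, if_neg hne, hv]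

theorem IsCircuitCode.exists_transition {n k N : ℕ} {C : ZMod N → Fin n → Bool}
    (hC : IsCircuitCode n k N C) :
    ∃ w : ℕ → Fin n, ∀ (i : ℕ) (t : Fin n), C i t ≠ C ((i + 1 : ℕ) : ZMod N) t ↔ w i = t := by
  have h : ∀ i : ℕ, ∃ s : Fin n, ∀ t, C i t ≠ C ((i + 1 : ℕ) : ZMod N) t ↔ s = t := by
    intro i
    have hi := hC.adj i
    unfold hammingDist at hi
    obtain ⟨s, hs⟩ := Finset.card_eq_one.1 hi
    refine ⟨s, fun t => ?_⟩
    have ht := Finset.ext_iff.1 hs t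
    simpa [eq_comm] using ht
  choose w hw using h
  exact ⟨w, hw⟩

theorem IsCircuitCode.le_two_mul {n k N : ℕ} {C : ZMod N → Fin n → Bool}
    (hC : IsCircuitCode n k N C) (h : n < 3 * k / 2 + 2) : N ≤ 2 * n := by
  by_contra! hN
  obtain ⟨w, hw⟩ := hC.exists_transition
  set f : ℕ → Fin n → Bool := fun i => C i with hf
  replace hw : ∀ i t, f i t ≠ f (i + 1) t ↔ w i = t := hw
  have far : ∀ i L, 0 < L → k ≤ L → L + k ≤ N → L < N → k ≤ hammingDist (f i) (f (i + L)) := by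
    intro i L h0 hkL hLN hlt
    by_contra! hlt'
    have := hC.spread i ((i + L : ℕ) : ZMod N) hlt'
    rw [cycDist_natCast_add i h0 hlt] at this
    change _ = hammingDist (f i) (f (i + L)) at this
    omega
  have hNeven : N % 2 = 0 := by
    have := hammingDist_mod_two hw 0 N
    simpa [hf] using this.symm
  have hdim : ∀ i L, hammingDist (f i) (f (i + L)) ≤ n := fun i L => by
    simpa using hammingDist_le_card_fintype (x := f i) (y := f (i + L))
  rcases lt_or_ge n k with hnk | hnk
  · have hd := hdim 0 (n + 1)
    rcases Nat.lt_or_ge (n + 1) N with hlt | hge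
    · have := hC.spread (0 : ℕ) ((0 + (n + 1) : ℕ) : ZMod N) (lt_of_le_of_lt hd hnk)
      rw [cycDist_natCast_add 0 (Nat.succ_pos n) hlt] at this
      change _ = hammingDist (f 0) (f (0 + (n + 1))) at this
      omega
    · have hn0 : n = 0 := by omega
      subst hn0
      exact (w 0).elim0
  have hone : ∀ i s, occ w i (k + 1) s ≤ 1 := by
    intro i s
    refine occ_le_one_of_le_hammingDist hw ?_ s
    have h1 := far i (k + 1) (by omega) (by omega) (by omega) (by omega)
    have h2 := hammingDist_mod_two hw i (k + 1)
    omega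
  have hkn : k + 1 ≤ n := by
    calc k + 1 = ∑ s, occ w 0 (k + 1) s := (sum_occ w 0 (k + 1)).symm
      _ ≤ ∑ _s : Fin n, 1 := Finset.sum_le_sum fun s _ => hone 0 s
      _ = n := by simp
  obtain ⟨i, hi⟩ : ∃ i, w i ≠ w (i + (k + 1)) := by
    by_contra! hper
    have hz : f 0 = f (0 + ((k + 1) + (k + 1))) := by
      ext1 s
      by_contra hne
      rw [← ne_eq, ne_iff_odd_occ hw, occ_add] at hne
      have : occ w (0 + (k + 1)) (k + 1) s = occ w 0 (k + 1) s := by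
        unfold occ
        refine Finset.sum_congr rfl fun j _ => ?_
        rw [hper (0 + j), show 0 + (k + 1) + j = 0 + j + (k + 1) by ring]
      rw [this, Nat.odd_iff] at hne
      omega
    have h0 := hC.inj hz
    have hc := cycDist_natCast_add (N := N) 0 (L := (k + 1) + (k + 1)) (by omega) (by omega)
    rw [← h0] at hc
    simp [cycDist] at hc
    omega
  have htwo : ∀ s, occ w i (2 * n - k + 1) s ≤ 2 := fun s =>
    (occ_mono w (by omega) s).trans (occ_le_two w hone hi s)
  have h1 := hammingDist_add_le_of_occ_le_two hw htwo
  have h2 := far i (2 * n - k + 1) (by omega) (by omega) (by omega) (by omega)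
  omega

/-- The cycle of length `2n` in the `n`-cube that flips the coordinates `0, …, n - 1` in order,
twice. -/
def antipodalCycle (n : ℕ) (i : ZMod (2 * n)) (s : Fin n) : Bool :=
  decide (s.val < i.val ∧ i.val ≤ s.val + n)

theorem hammingDist_antipodalCycle {n : ℕ} [NeZero (2 * n)] (i j : ZMod (2 * n)) :
    hammingDist (antipodalCycle n i) (antipodalCycle n j) = cycDist i j := by
  wlog h : i.val ≤ j.val generalizing i j
  · rw [hammingDist_comm, cycDist_comm]
    exact this j i (by omega)
  rw [cycDist_of_val_le h]
  have hj := j.val_lt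
  unfold hammingDist antipodalCycle
  generalize i.val = a at *
  generalize j.val = b at *
  have key : (Finset.univ.filter fun s : Fin n =>
      decide (s.val < a ∧ a ≤ s.val + n) ≠ decide (s.val < b ∧ b ≤ s.val + n)).card
      = ((Finset.range n).filter fun s =>
        ¬ ((s < a ∧ a ≤ s + n) ↔ (s < b ∧ b ≤ s + n))).card := by
    rw [Finset.card_filter, Finset.card_filter, ← Fin.sum_univ_eq_sum_range (fun s =>
      if ¬ ((s < a ∧ a ≤ s + n) ↔ (s < b ∧ b ≤ s + n)) then 1 else 0)]
    simp only [ne_eq, decide_eq_decide]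
  rw [key]
  rcases le_or_gt b n with hb | hb
  · have : ((Finset.range n).filter fun s =>
        ¬ ((s < a ∧ a ≤ s + n) ↔ (s < b ∧ b ≤ s + n))) = Finset.Ico a b := by
      ext s; simp only [Finset.mem_filter, Finset.mem_range, Finset.mem_Ico]; omega
    rw [this, Nat.card_Ico]; omega
  rcases le_or_gt a n with ha | ha
  · have : ((Finset.range n).filter fun s =>
        ¬ ((s < a ∧ a ≤ s + n) ↔ (s < b ∧ b ≤ s + n)))
        = Finset.Ico 0 (min a (b - n)) ∪ Finset.Ico (max a (b - n)) n := by
      ext s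
      simp only [Finset.mem_filter, Finset.mem_range, Finset.mem_Ico, Finset.mem_union]
      omega
    rw [this, Finset.card_union_of_disjoint, Nat.card_Ico, Nat.card_Ico]
    · omega
    · rw [Finset.disjoint_left]
      intro s
      simp only [Finset.mem_Ico]
      omega
  · have : ((Finset.range n).filter fun s =>
        ¬ ((s < a ∧ a ≤ s + n) ↔ (s < b ∧ b ≤ s + n))) = Finset.Ico (a - n) (b - n) := by
      ext s; simp only [Finset.mem_filter, Finset.mem_range, Finset.mem_Ico]; omega
    rw [this, Nat.card_Ico]; omega

theorem eq_of_val_sub_eq_one {N : ℕ} [NeZero N] {i j : ZMod N} (h : (j - i).val = 1) :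
    j = i + 1 := by
  have := ZMod.natCast_zmod_val (j - i)
  rw [h, Nat.cast_one] at this
  rw [this]
  ring

theorem isCircuitCode_antipodalCycle {n : ℕ} (hn : 1 ≤ n) (k : ℕ) :
    IsCircuitCode n k (2 * n) (antipodalCycle n) := by
  have : NeZero (2 * n) := ⟨by omega⟩
  refine ⟨fun i j hij => ?_, fun i => ?_, fun i j _ h1 h2 => ?_, fun i j _ =>
    (hammingDist_antipodalCycle i j).symm⟩
  · have h0 := hammingDist_antipodalCycle i j
    rw [hij, hammingDist_self] at h0
    rcases min_choice (j - i).val (i - j).val with h | h <;>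
      rw [cycDist, h, eq_comm, ZMod.val_eq_zero, sub_eq_zero] at h0
    exacts [h0.symm, h0]
  · rw [hammingDist_antipodalCycle]
    have := cycDist_natCast_add (N := 2 * n) i.val one_pos (by omega)
    rw [Nat.cast_add, ZMod.natCast_zmod_val, Nat.cast_one] at this
    omega
  · rw [hammingDist_antipodalCycle]
    intro h
    rcases min_choice (j - i).val (i - j).val with h' | h' <;> rw [cycDist, h'] at h
    exacts [h1 (eq_of_val_sub_eq_one h), h2 (eq_of_val_sub_eq_one h)]

theorem stmt_16 (n k : ℕ) (hk : 0 < k) (hn : 2 ≤ n) (h : n < 3 * k / 2 + 2) :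
    K n k = 2 * n := by
  refine IsGreatest.csSup_eq ⟨⟨_, isCircuitCode_antipodalCycle (by omega) k⟩, ?_⟩
  rintro N ⟨C, hC⟩
  exact hC.le_two_mul h
end

section
/- (Singleton) For every natural number n ≥ 6, K(n, 3) ≥ 32 · 3^((n−8)/3), where the right-hand side is a real power and K is compared as a real number. -/
/-- A periodic two-way infinite presentation of a spread-3 circuit code: vertices at Hamming
distance less than 3 have indices differing, modulo the period, by exactly that distance. -/
structure IsPeriodicCode (n N : ℕ) (f : ℤ → Fin n → Bool) : Prop where
  periodic : ∀ i, f (i + N) = f i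
  adj : ∀ i, hammingDist (f i) (f (i + 1)) = 1
  spread : ∀ i j, hammingDist (f i) (f j) < 3 →
    ∃ e : ℤ, (N : ℤ) ∣ i - j - e ∧ e.natAbs = hammingDist (f i) (f j)

namespace IsPeriodicCode

variable {n N : ℕ} {f : ℤ → Fin n → Bool}

theorem add_mul_period (h : IsPeriodicCode n N f) (i k : ℤ) : f (i + N * k) = f i := by
  have hp : Function.Periodic f (N : ℤ) := h.periodic
  simpa [mul_comm] using hp.int_mul k i

theorem eq_of_dvd (h : IsPeriodicCode n N f) {i j : ℤ} (hij : (N : ℤ) ∣ i - j) : f i = f j := by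
  obtain ⟨k, hk⟩ := hij
  rw [← h.add_mul_period j k, ← hk, add_sub_cancel]

theorem hammingDist_eq_natAbs (h : IsPeriodicCode n N f) {a b : ℤ} (hab : (a - b).natAbs ≤ 1) :
    hammingDist (f a) (f b) = (a - b).natAbs := by
  obtain rfl | rfl | rfl : a = b ∨ b = a + 1 ∨ a = b + 1 := by omega
  · simp
  · rw [h.adj]; omega
  · rw [hammingDist_comm, h.adj]; omega

theorem isCircuitCode (h : IsPeriodicCode n N f) (hN : 4 ≤ N) :
    IsCircuitCode n 3 N (fun i : ZMod N => f i.val) := by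
  have : NeZero N := ⟨by omega⟩
  have key : ∀ i j : ZMod N, hammingDist (f i.val) (f j.val) < 3 →
      i - j = (hammingDist (f i.val) (f j.val) : ZMod N) ∨
      j - i = (hammingDist (f i.val) (f j.val) : ZMod N) := by
    intro i j hij
    obtain ⟨e, he, hd⟩ := h.spread _ _ hij
    rw [← hd]
    have h1 : i - j = (e : ZMod N) := by
      have := (ZMod.intCast_zmod_eq_zero_iff_dvd _ N).2 he
      push_cast at this
      simpa [sub_eq_zero] using this
    rcases Int.natAbs_eq e with h2 | h2
    · left; rw [h1]; conv_lhs => rw [h2]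
      simp
    · right; rw [← neg_sub, h1]; conv_lhs => rw [h2]
      simp
  refine ⟨?_, ?_, ?_, ?_⟩
  · intro i j hij
    have hd : hammingDist (f i.val) (f j.val) = 0 := hammingDist_eq_zero.2 hij
    rcases key i j (by omega) with h1 | h1 <;> rw [hd, Nat.cast_zero, sub_eq_zero] at h1
    · exact h1
    · exact h1.symm
  · intro i
    have : f (i + 1 : ZMod N).val = f (i.val + 1) := by
      apply h.eq_of_dvd
      rw [← ZMod.intCast_zmod_eq_zero_iff_dvd]
      simp
    simp only [this, h.adj]
  · intro i j _ h2 h3 hd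
    rcases key i j (by omega) with h4 | h4 <;> rw [hd, Nat.cast_one, sub_eq_iff_eq_add'] at h4
    · exact h3 h4
    · exact h2 h4
  · have aux : ∀ (a : ℕ) (x : ZMod N), a < 3 → x = a → min (-x).val x.val = a := by
      rintro a x ha rfl
      have hv : (a : ZMod N).val = a := ZMod.val_cast_of_lt (by omega)
      rw [ZMod.neg_val, hv]
      split_ifs with h0
      · rw [← hv, h0]; simp
      · omega
    intro i j hij
    unfold cycDist
    rcases key i j hij with h1 | h1
    · have := aux _ _ hij h1
      rwa [neg_sub] at this
    · have := aux _ _ hij h1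
      rwa [neg_sub, min_comm] at this

end IsPeriodicCode

theorem hammingDist_append {α : Type*} [DecidableEq α] {n m : ℕ} (a b : Fin n → α)
    (c d : Fin m → α) :
    hammingDist (Fin.append a c) (Fin.append b d) = hammingDist a b + hammingDist c d := by
  simp [hammingDist, Finset.card_filter, Fin.sum_univ_add]

/-- A spread-3 path in `ℤ × I(m)` that is invariant, after `L` steps, under translation of the
first coordinate by `p`. -/
structure IsPattern (m p L : ℕ) (x : ℤ → ℤ) (q : ℤ → Fin m → Bool) : Prop where
  fst_add : ∀ t, x (t + L) = x t + p
  snd_add : ∀ t, q (t + L) = q t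
  adj : ∀ t, (x t - x (t + 1)).natAbs + hammingDist (q t) (q (t + 1)) = 1
  spread : ∀ s t, (x s - x t).natAbs + hammingDist (q s) (q t) < 3 →
    (s - t).natAbs = (x s - x t).natAbs + hammingDist (q s) (q t)

/-- Following a pattern along a code multiplies the length of the code by `L / p`. -/
theorem IsPeriodicCode.append_pattern {n m p L N : ℕ} {f : ℤ → Fin n → Bool} {x : ℤ → ℤ}
    {q : ℤ → Fin m → Bool} (hf : IsPeriodicCode n (p * N) f) (h : IsPattern m p L x q) :
    IsPeriodicCode (n + m) (L * N) (fun t => Fin.append (f (x t)) (q t)) := by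
  have hq : ∀ t k : ℤ, q (t + L * k) = q t := by
    intro t k
    have hp : Function.Periodic q (L : ℤ) := h.snd_add
    simpa [mul_comm] using hp.int_mul k t
  have hx : ∀ t k : ℤ, x (t + L * k) = x t + p * k := by
    intro t k
    induction k using Int.induction_on with
    | zero => simp
    | succ k ih =>
      have := h.fst_add (t + L * k)
      rw [show t + L * ((k : ℤ) + 1) = t + L * k + L by ring, this, ih]
      ring
    | pred k ih =>
      have := h.fst_add (t + L * (-k - 1))
      rw [show t + L * (-(k : ℤ) - 1) + L = t + L * -k by ring, ih] at this
      linear_combination -this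
  refine ⟨?_, ?_, ?_⟩
  · intro t
    have h1 := hx t N
    have h2 := hf.add_mul_period (x t) 1
    push_cast at h2 ⊢
    rw [hq, h1, ← h2, mul_one]
  · intro t
    have := h.adj t
    rw [hammingDist_append, hf.hammingDist_eq_natAbs (by omega), this]
  · intro s t
    simp only [hammingDist_append]
    intro hst
    obtain ⟨e, ⟨k, hk⟩, he⟩ := hf.spread (x s) (x t) (by omega)
    have h1 : x s - x (t + L * (N * k)) = e := by
      rw [hx]
      push_cast at hk
      linear_combination hk
    have h2 := h.spread s (t + L * (N * k))
    rw [h1, hq, he] at h2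
    refine ⟨_, ⟨k, ?_⟩, h2 hst⟩
    push_cast
    ring

/-- The number of positions below `m` at which the binary digits of `a` and `b` differ. -/
def bitDist (a b : ℕ) : ℕ → ℕ
  | 0 => 0
  | m + 1 => bitDist a b m + if a.testBit m = b.testBit m then 0 else 1

theorem hammingDist_testBit (a b m : ℕ) :
    hammingDist (fun i : Fin m => a.testBit i) (fun i => b.testBit i) = bitDist a b m := by
  induction m with
  | zero => simp [bitDist, hammingDist]
  | succ m ih =>
    rw [bitDist, ← ih]
    simp [hammingDist, Finset.card_filter, Fin.sum_univ_castSucc]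

/-- The pattern of displacement 4 whose first period is listed by `X` and, in binary, `Q`. -/
theorem isPattern_of_lists (m L : ℕ) (X Q : List ℕ) (hL : 0 < L)
    (hX : ∀ r < L, X.getD r 0 ≤ 6)
    (hadj : ∀ r : ℕ, r < L →
      ((X.getD r 0 : ℤ) - (4 * ((r + 1) / L : ℕ) + X.getD ((r + 1) % L) 0)).natAbs +
      bitDist (Q.getD r 0) (Q.getD ((r + 1) % L) 0) m = 1)
    (hspread : ∀ r : ℕ, r < L → ∀ s : ℕ, s < L → ∀ k : ℕ, k < 5 →
      (4 * ((k : ℤ) - 2) + (X.getD r 0 - X.getD s 0)).natAbs +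
        bitDist (Q.getD r 0) (Q.getD s 0) m < 3 →
      (L * ((k : ℤ) - 2) + (r - s)).natAbs =
        (4 * ((k : ℤ) - 2) + (X.getD r 0 - X.getD s 0)).natAbs +
        bitDist (Q.getD r 0) (Q.getD s 0) m) :
    IsPattern m 4 L (fun t => 4 * (t / L) + X.getD (t % L).toNat 0)
      (fun t i => (Q.getD (t % L).toNat 0).testBit i) := by
  have hL' : (0 : ℤ) < L := by exact_mod_cast hL
  have split : ∀ t : ℤ, ∃ (k : ℤ) (r : ℕ), r < L ∧ t = r + L * k := fun t =>
    ⟨t / L, (t % L).toNat, by have := Int.emod_lt_of_pos t hL'; omega, by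
      rw [Int.toNat_of_nonneg (Int.emod_nonneg _ hL'.ne'), Int.emod_add_mul_ediv]⟩
  have hdiv : ∀ (k : ℤ) (r : ℕ), ((r : ℤ) + L * k) / L = (r / L : ℕ) + k := by
    intro k r
    rw [Int.add_mul_ediv_left _ _ hL'.ne']
    simp
  have hmod : ∀ (k : ℤ) (r : ℕ), (((r : ℤ) + L * k) % L).toNat = r % L := by
    intro k r
    rw [Int.add_mul_emod_self_left, ← Int.natCast_mod, Int.toNat_natCast]
  refine ⟨?_, ?_, ?_, ?_⟩
  · intro t
    simp only [Int.add_emod_right, Int.add_ediv_of_dvd_right (dvd_refl (L : ℤ)),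
      Int.ediv_self hL'.ne']
    push_cast
    ring
  · intro t
    simp only [Int.add_emod_right]
  · intro t
    obtain ⟨k, r, hr, rfl⟩ := split t
    have := hadj r hr
    have e : (r : ℤ) + L * k + 1 = ((r + 1 : ℕ) : ℤ) + L * k := by push_cast; ring
    simp only [hammingDist_testBit, e, hdiv, hmod, Nat.mod_eq_of_lt hr, Nat.div_eq_of_lt hr]
    refine Eq.trans ?_ this
    congr 2
    push_cast
    ring
  · intro s t
    obtain ⟨k, r, hr, rfl⟩ := split s
    obtain ⟨l, u, hu, rfl⟩ := split t
    simp only [hammingDist_testBit, hdiv, hmod, Nat.mod_eq_of_lt hr, Nat.div_eq_of_lt hr,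
      Nat.mod_eq_of_lt hu, Nat.div_eq_of_lt hu]
    intro hd
    have h1 := hX r hr
    have h2 := hX u hu
    have hk : ((k - l + 2).toNat : ℤ) = k - l + 2 := by omega
    have := hspread r hr u hu (k - l + 2).toNat (by omega)
    rw [hk] at this
    have e1 : 4 * (k - l + 2 - 2) + ((X.getD r 0 : ℤ) - X.getD u 0) =
      4 * (((0 : ℕ) : ℤ) + k) + X.getD r 0 - (4 * (((0 : ℕ) : ℤ) + l) + X.getD u 0) := by
      push_cast; ring
    have e2 : (L : ℤ) * (k - l + 2 - 2) + (r - u) = r + L * k - (u + L * l) := by ring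
    rw [e1, e2] at this
    exact this hd

/-- There is a periodic code of dimension `n` and period `4 * N`. -/
def HasPeriodicCode (n N : ℕ) : Prop := ∃ f, IsPeriodicCode n (4 * N) f

theorem hasPeriodicCode_two : HasPeriodicCode 2 1 := by
  have hr : ∀ i : ℤ, ∃ r < 4, (i % 4).toNat = r ∧ i % 4 = r := fun i =>
    ⟨(i % 4).toNat, by omega, rfl, by omega⟩
  refine ⟨fun i j => (([0, 1, 3, 2] : List ℕ).getD (i % 4).toNat 0).testBit j, ?_, ?_, ?_⟩
  · intro i
    simp
  · intro i
    rw [hammingDist_testBit]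
    obtain ⟨r, h1, h2, h3⟩ := hr i
    have h4 : ((i + 1) % 4).toNat = (r + 1) % 4 := by omega
    rw [h2, h4]
    clear h2 h3 h4
    revert r
    decide
  · intro i j
    rw [hammingDist_testBit]
    obtain ⟨r, h1, h2, h3⟩ := hr i
    obtain ⟨s, h4, h5, h6⟩ := hr j
    rw [h2, h5]
    intro _
    have key : ∀ r : ℕ, r < 4 → ∀ s : ℕ, s < 4 → ∃ e : ℕ, e < 5 ∧
        ((4 : ℕ) : ℤ) ∣ (r : ℤ) - s - ((e : ℤ) - 2) ∧
        ((e : ℤ) - 2).natAbs = bitDist (([0, 1, 3, 2] : List ℕ).getD r 0)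
          (([0, 1, 3, 2] : List ℕ).getD s 0) 2 := by
      decide
    obtain ⟨e, -, he, hd⟩ := key r h1 s h4
    exact ⟨_, by omega, hd⟩

theorem HasPeriodicCode.add_two {n N : ℕ} (h : HasPeriodicCode n N) :
    HasPeriodicCode (n + 2) (2 * N) := by
  obtain ⟨f, hf⟩ := h
  have := hf.append_pattern (isPattern_of_lists 2 8 [0, 1, 1, 2, 2, 3, 3, 4]
    [0, 0, 1, 1, 3, 3, 2, 2] (by decide) (by decide +kernel) (by decide +kernel)
    (by decide +kernel))
  rw [show 8 * N = 4 * (2 * N) by ring] at this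
  exact ⟨_, this⟩

theorem HasPeriodicCode.add_five {n N : ℕ} (h : HasPeriodicCode n N) :
    HasPeriodicCode (n + 5) (6 * N) := by
  obtain ⟨f, hf⟩ := h
  have := hf.append_pattern (isPattern_of_lists 5 24
    [0, 0, 0, 1, 1, 2, 2, 3, 3, 3, 3, 2, 2, 2, 2, 3, 3, 4, 4, 5, 5, 5, 5, 4]
    [0, 1, 3, 3, 19, 19, 23, 23, 21, 29, 13, 13, 9, 8, 10, 10, 26, 26, 30, 30, 28, 20, 4, 4]
    (by decide) (by decide +kernel) (by decide +kernel) (by decide +kernel))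
  rw [show 24 * N = 4 * (6 * N) by ring] at this
  exact ⟨_, this⟩

theorem HasPeriodicCode.add_six {n N : ℕ} (h : HasPeriodicCode n N) :
    HasPeriodicCode (n + 6) (9 * N) := by
  obtain ⟨f, hf⟩ := h
  have := hf.append_pattern (isPattern_of_lists 6 36
    [1, 0, 0, 0, 0, 1, 1, 1, 2, 2, 3, 3, 3, 4, 4, 4, 4, 3, 3, 2, 2, 2, 2, 3, 3, 3, 4, 4, 5, 5, 5,
      6, 6, 6, 6, 5]
    [0, 0, 16, 20, 22, 22, 30, 14, 14, 46, 46, 62, 58, 58, 59, 51, 35, 35, 3, 3, 19, 27, 25, 25,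
      29, 13, 13, 45, 45, 61, 53, 53, 52, 48, 32, 32]
    (by decide) (by decide +kernel) (by decide +kernel) (by decide +kernel))
  rw [show 36 * N = 4 * (9 * N) by ring] at this
  exact ⟨_, this⟩

theorem exists_hasPeriodicCode (n : ℕ) (hn : 6 ≤ n) :
    ∃ N, HasPeriodicCode n N ∧ 32 ^ 3 * 3 ^ n ≤ (4 * N) ^ 3 * 3 ^ 8 := by
  induction n using Nat.strong_induction_on with
  | _ n ih =>
    have h6 : HasPeriodicCode 6 4 := hasPeriodicCode_two.add_two.add_two
    have h7 : HasPeriodicCode 7 6 := hasPeriodicCode_two.add_five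
    have h8 : HasPeriodicCode 8 9 := hasPeriodicCode_two.add_six
    by_cases hlt : n < 12
    · interval_cases n
      · exact ⟨_, h6, by norm_num⟩
      · exact ⟨_, h7, by norm_num⟩
      · exact ⟨_, h8, by norm_num⟩
      · exact ⟨_, h7.add_two, by norm_num⟩
      · exact ⟨_, h8.add_two, by norm_num⟩
      · exact ⟨_, h7.add_two.add_two, by norm_num⟩
    · obtain ⟨k, rfl⟩ : ∃ k, n = k + 6 := ⟨n - 6, by omega⟩
      obtain ⟨N, hN, hle⟩ := ih k (by omega) (by omega)
      refine ⟨_, hN.add_six, ?_⟩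
      calc 32 ^ 3 * 3 ^ (k + 6) = 3 ^ 6 * (32 ^ 3 * 3 ^ k) := by ring
        _ ≤ 3 ^ 6 * ((4 * N) ^ 3 * 3 ^ 8) := Nat.mul_le_mul_left _ hle
        _ = (4 * (9 * N)) ^ 3 * 3 ^ 8 := by ring

theorem ExistsCircuitCode.le_K {n k N : ℕ} (h : ExistsCircuitCode n k N) : N ≤ K n k := by
  refine le_csSup ⟨2 ^ n, ?_⟩ h
  rintro M ⟨C, hC⟩
  rcases Nat.eq_zero_or_pos M with rfl | hM
  · exact Nat.zero_le _
  · have : NeZero M := ⟨hM.ne'⟩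
    simpa [ZMod.card] using Fintype.card_le_of_injective C hC.inj

theorem stmt_18 (n : ℕ) (hn : 6 ≤ n) :
    (32 : ℝ) * 3 ^ (((n : ℝ) - 8) / 3) ≤ (K n 3 : ℝ) := by
  obtain ⟨N, ⟨f, hf⟩, hle⟩ := exists_hasPeriodicCode n hn
  have hN : N ≠ 0 := by
    rintro rfl
    simp at hle
  have hK : ((4 * N : ℕ) : ℝ) ≤ K n 3 := by
    exact_mod_cast ExistsCircuitCode.le_K ⟨_, hf.isCircuitCode (by omega)⟩
  refine le_trans ?_ hK
  refine le_of_pow_le_pow_left₀ (n := 3) (by norm_num) (by positivity) ?_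
  have hpow : ((3 : ℝ) ^ (((n : ℝ) - 8) / 3)) ^ 3 = 3 ^ n / 3 ^ 8 := by
    rw [← Real.rpow_natCast, ← Real.rpow_mul (by norm_num)]
    push_cast
    rw [div_mul_cancel₀ _ (by norm_num), Real.rpow_sub (by norm_num), Real.rpow_natCast]
    norm_num
  rw [mul_pow, hpow, ← mul_div_assoc, div_le_iff₀ (by positivity)]
  exact_mod_cast hle
end
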